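/- Fix n N : ℕ, Δs ≥ 0, Λ ≥ 0, ε ≥ 0, v_min > 0, and L ≥ 0. Let F, g, ĝ : (Fin n → ℝ) → (Fin n → ℝ) satisfy: (i) x ↦ F x + ĝ x is Lipschitz with constant Λ for the Euclidean norm; (ii) ‖g x − ĝ x‖ ≤ ε for every x. Let h : (Fin n → ℝ) → ℝ be Lipschitz with constant L and satisfy h x ≥ v_min for all x. Define x, x̂ : ℕ → (Fin n → ℝ) by x 0 = x̂ 0, x (k+1) = x k + Δs • (F (x k) + g (x k)), x̂ (k+1) = x̂ k + Δs • (F (x̂ k) + ĝ (x̂ k)), and define lap times J = ∑_{k=0}^{N−1} Δs / h (x k) and Ĵ = ∑_{k=0}^{N−1} Δs / h (x̂ k). Then |J − Ĵ| ≤ (Δs / v_min²) · L · ( ∑_{k=0}^{N−1} Δs · ∑_{r=0}^{k−1} (1 + Δs·Λ)^r ) · ε; in particular |J − Ĵ| ≤ C ε for the finite constant C = (Δs² L / v_min²) ∑_{k<N} ∑_{r<k} (1 + Δs·Λ)^r. -/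

import Mathlib

/-- Discrete Grönwall inequality with constant coefficients. -/
lemma le_mul_geom_sum_of_affine_recurrence {a : ℕ → ℝ} {q b : ℝ} (hq : 0 ≤ q) (h0 : a 0 ≤ 0)
    (ha : ∀ k, a (k + 1) ≤ q * a k + b) (k : ℕ) :
    a k ≤ b * ∑ r ∈ Finset.range k, q ^ r := by
  induction k with
  | zero => simpa using h0
  | succ k ih =>
    calc a (k + 1) ≤ q * a k + b := ha k
      _ ≤ q * (b * ∑ r ∈ Finset.range k, q ^ r) + b := by gcongr
      _ = b * ∑ r ∈ Finset.range (k + 1), q ^ r := by rw [geom_sum_succ]; ring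

/-- One Euler step of a perturbed Lipschitz vector field expands distances by at most `1 + t * Λ`,
up to the error `t * ε` caused by the perturbation. -/
lemma norm_euler_step_sub_le {E : Type*} [NormedAddCommGroup E] [NormedSpace ℝ E]
    {f f' : E → E} {t Λ ε : ℝ} (ht : 0 ≤ t)
    (hLip : ∀ x y, ‖f' x - f' y‖ ≤ Λ * ‖x - y‖) (hmis : ∀ x, ‖f x - f' x‖ ≤ ε) (x y : E) :
    ‖(x + t • f x) - (y + t • f' y)‖ ≤ (1 + t * Λ) * ‖x - y‖ + t * ε := by
  have hsplit : (x + t • f x) - (y + t • f' y)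
      = (x - y) + t • (f' x - f' y) + t • (f x - f' x) := by module
  calc ‖(x + t • f x) - (y + t • f' y)‖
      ≤ ‖x - y‖ + ‖t • (f' x - f' y)‖ + ‖t • (f x - f' x)‖ := hsplit ▸ norm_add₃_le
    _ = ‖x - y‖ + t * ‖f' x - f' y‖ + t * ‖f x - f' x‖ := by
      simp only [norm_smul, Real.norm_of_nonneg ht]
    _ ≤ ‖x - y‖ + t * (Λ * ‖x - y‖) + t * ε := by
      gcongr
      exacts [hLip x y, hmis x]
    _ = (1 + t * Λ) * ‖x - y‖ + t * ε := by ring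

lemma abs_div_sub_div_le {t v a b : ℝ} (ht : 0 ≤ t) (hv : 0 < v) (ha : v ≤ a) (hb : v ≤ b) :
    |t / a - t / b| ≤ t / v ^ 2 * |a - b| := by
  have ha' : 0 < a := hv.trans_le ha
  have hb' : 0 < b := hv.trans_le hb
  have heq : t / a - t / b = t * (b - a) / (a * b) := by field_simp
  rw [heq, abs_div, abs_mul, abs_of_nonneg ht, abs_of_pos (mul_pos ha' hb'), abs_sub_comm b a,
    div_mul_eq_mul_div, sq]
  gcongr

/-- Rigorous discrete form of the paper's Proposition 1: the true lap time `J` and the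
simulated lap time `Ĵ` (computed along trajectories driven by the true residual `g`
and the learned residual `ĝ`, respectively) differ by at most `C ε`, where `ε` bounds
the uniform residual mismatch, `h` is the `L`-Lipschitz progress rate bounded below by
`v_min > 0`, and `C = (Δs² L / v_min²) ∑_{k<N} ∑_{r<k} (1 + Δs Λ)^r`. -/
theorem lap_time_evaluation_error_bound (n N : ℕ)
    (Δs : ℝ) (hΔs : 0 ≤ Δs) (Λ : ℝ) (hΛ : 0 ≤ Λ) (ε : ℝ) (hε : 0 ≤ ε)
    (vmin : ℝ) (hvmin : 0 < vmin) (L : ℝ) (hL : 0 ≤ L)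
    (F g ghat : EuclideanSpace ℝ (Fin n) → EuclideanSpace ℝ (Fin n))
    (hLip : ∀ x y : EuclideanSpace ℝ (Fin n),
      ‖(F x + ghat x) - (F y + ghat y)‖ ≤ Λ * ‖x - y‖)
    (hmismatch : ∀ x : EuclideanSpace ℝ (Fin n), ‖g x - ghat x‖ ≤ ε)
    (h : EuclideanSpace ℝ (Fin n) → ℝ)
    (hhLip : ∀ x y : EuclideanSpace ℝ (Fin n), |h x - h y| ≤ L * ‖x - y‖)
    (hhpos : ∀ x : EuclideanSpace ℝ (Fin n), vmin ≤ h x)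
    (x xhat : ℕ → EuclideanSpace ℝ (Fin n))
    (h0 : x 0 = xhat 0)
    (hx : ∀ k, x (k + 1) = x k + Δs • (F (x k) + g (x k)))
    (hxhat : ∀ k, xhat (k + 1) = xhat k + Δs • (F (xhat k) + ghat (xhat k))) :
    |(∑ k ∈ Finset.range N, Δs / h (x k)) - ∑ k ∈ Finset.range N, Δs / h (xhat k)| ≤
        (Δs / vmin ^ 2) * L *
          (∑ k ∈ Finset.range N, Δs * ∑ r ∈ Finset.range k, (1 + Δs * Λ) ^ r) * ε ∧
      |(∑ k ∈ Finset.range N, Δs / h (x k)) - ∑ k ∈ Finset.range N, Δs / h (xhat k)| ≤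
        (Δs ^ 2 * L / vmin ^ 2 *
          ∑ k ∈ Finset.range N, ∑ r ∈ Finset.range k, (1 + Δs * Λ) ^ r) * ε := by
  have hdist (k : ℕ) :
      ‖x k - xhat k‖ ≤ Δs * ε * ∑ r ∈ Finset.range k, (1 + Δs * Λ) ^ r := by
    refine le_mul_geom_sum_of_affine_recurrence (a := fun k => ‖x k - xhat k‖) (by positivity)
      (by simp [h0]) (fun k => ?_) k
    simp only [hx, hxhat]
    exact norm_euler_step_sub_le (f := fun z => F z + g z) (f' := fun z => F z + ghat z) hΔs hLip
      (fun z => by simpa using hmismatch z) _ _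
  have hbound : |(∑ k ∈ Finset.range N, Δs / h (x k)) - ∑ k ∈ Finset.range N, Δs / h (xhat k)| ≤
      (Δs / vmin ^ 2) * L *
        (∑ k ∈ Finset.range N, Δs * ∑ r ∈ Finset.range k, (1 + Δs * Λ) ^ r) * ε := by
    rw [← Finset.sum_sub_distrib, Finset.mul_sum, Finset.sum_mul]
    refine (Finset.abs_sum_le_sum_abs _ _).trans (Finset.sum_le_sum fun k _ => ?_)
    calc |Δs / h (x k) - Δs / h (xhat k)|
        ≤ Δs / vmin ^ 2 * |h (x k) - h (xhat k)| :=
          abs_div_sub_div_le hΔs hvmin (hhpos _) (hhpos _)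
      _ ≤ Δs / vmin ^ 2 * (L * (Δs * ε * ∑ r ∈ Finset.range k, (1 + Δs * Λ) ^ r)) := by
          gcongr
          exact (hhLip _ _).trans (mul_le_mul_of_nonneg_left (hdist k) hL)
      _ = Δs / vmin ^ 2 * L * (Δs * ∑ r ∈ Finset.range k, (1 + Δs * Λ) ^ r) * ε := by ring
  refine ⟨hbound, hbound.trans_eq ?_⟩
  rw [← Finset.mul_sum]
  ring
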